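/- Let {X_t}_{t≥1} be a finite-state irreducible Markov chain with state space S, transition probability matrix P, initial distribution q and stationary distribution π. Let V_q = ‖(q_x/π_x)_{x∈S}‖₂. Let P' be the adjoint of P on ℓ²(π), defined by p'_{xy} = (π_y p_{yx})/π_x for all x,y ∈ S, let Ṗ = P'P be the multiplicative symmetrization of P, and let υ = 1 − λ₂ where λ₂ is the second largest eigenvalue of Ṗ. Let f : S → ℝ satisfy Σ_{y∈S} π_y f(y) = 0, ‖f‖_∞ ≤ 1 and 0 < ‖f‖₂² ≤ 1. If Ṗ is irreducible, then for every positive integer T and every γ with 0 < γ ≤ 1, P( (1/T) Σ_{t=1}^T f(X_t) ≥ γ ) ≤ V_q · exp( − T γ² υ / 28 ). -/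

import Mathlib

open Finset MeasureTheory

namespace LezaudAux

set_option linter.unusedSectionVars false

variable {S : Type*} [Fintype S] [DecidableEq S]

theorem contraction (P : Matrix S S ℝ) (hP0 : ∀ x y, 0 ≤ P x y) (hP1 : ∀ x, ∑ y, P x y = 1)
    (π : S → ℝ) (hπpos : ∀ x, 0 < π x) (hstat : ∀ y, ∑ x, π x * P x y = π y) (u : S → ℝ) :
    ∑ x, π x * (P.mulVec u x) ^ 2 ≤ ∑ x, π x * u x ^ 2 := by
  have h1 : ∀ x, (P.mulVec u x) ^ 2 ≤ ∑ y, P x y * u y ^ 2 := by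
    intro x
    have h := Finset.sum_mul_sq_le_sq_mul_sq univ (fun y => Real.sqrt (P x y))
      (fun y => Real.sqrt (P x y) * u y)
    simp only [mul_pow, Real.sq_sqrt (hP0 x _), hP1, one_mul, ← mul_assoc,
      Real.mul_self_sqrt (hP0 x _)] at h
    simpa [Matrix.mulVec, dotProduct] using h
  calc ∑ x, π x * (P.mulVec u x) ^ 2 ≤ ∑ x, π x * ∑ y, P x y * u y ^ 2 :=
        sum_le_sum fun x _ => mul_le_mul_of_nonneg_left (h1 x) (hπpos x).le
    _ = ∑ y, (∑ x, π x * P x y) * u y ^ 2 := by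
        simp_rw [mul_sum, sum_mul]
        rw [sum_comm]
        simp only [mul_assoc]
    _ = _ := by simp_rw [hstat]

theorem mean_mulVec (P : Matrix S S ℝ) (π : S → ℝ)
    (hstat : ∀ y, ∑ x, π x * P x y = π y) (u : S → ℝ) :
    ∑ x, π x * P.mulVec u x = ∑ x, π x * u x := by
  simp only [Matrix.mulVec, dotProduct, mul_sum]
  rw [sum_comm]
  refine sum_congr rfl fun y _ => ?_
  rw [← hstat y, sum_mul]
  simp [mul_assoc]

/-- `⟨u, Ṗ w⟩_π = ⟨P u, P w⟩_π` -/
theorem form (P Padj Pdot : Matrix S S ℝ) (π : S → ℝ) (hπpos : ∀ x, 0 < π x)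
    (hPadj : ∀ x y, Padj x y = π y * P y x / π x) (hPdot : Pdot = Padj * P) (u w : S → ℝ) :
    ∑ x, π x * (u x * Pdot.mulVec w x) = ∑ x, π x * (P.mulVec u x * P.mulVec w x) := by
  have h : ∀ x, π x * (u x * Pdot.mulVec w x) = ∑ z, π z * (P z x * u x) * P.mulVec w z := by
    intro x
    rw [hPdot, ← Matrix.mulVec_mulVec, Matrix.mulVec, dotProduct, mul_sum, mul_sum]
    refine sum_congr rfl fun z _ => ?_
    rw [hPadj]
    have := (hπpos x).ne'
    field_simp
  simp_rw [h]
  rw [sum_comm]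
  refine sum_congr rfl fun z _ => ?_
  rw [← sum_mul, ← mul_sum, ← mul_assoc]
  rfl

theorem pow_stoch (Q : Matrix S S ℝ) (h0 : ∀ x y, 0 ≤ Q x y) (n : ℕ) :
    (∀ x y, 0 ≤ (Q ^ n) x y) := by
  induction n with
  | zero => intro x y; simp [Matrix.one_apply]; split_ifs <;> norm_num
  | succ n ih =>
    intro x y
    rw [pow_succ, Matrix.mul_apply]
    exact sum_nonneg fun z _ => mul_nonneg (ih _ _) (h0 _ _)

theorem pow_fix (Q : Matrix S S ℝ) (u : S → ℝ) (hu : Q.mulVec u = u) (n : ℕ) :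
    (Q ^ n).mulVec u = u := by
  induction n with
  | zero => simp
  | succ n ih => rw [pow_succ, ← Matrix.mulVec_mulVec, hu, ih]

theorem const_of_fix [Nonempty S] (Q : Matrix S S ℝ) (h0 : ∀ x y, 0 ≤ Q x y)
    (h1 : Q.mulVec (fun _ => 1) = fun _ => 1)
    (hirr : ∀ x y, ∃ n, 1 ≤ n ∧ 0 < (Q ^ n) x y) (u : S → ℝ) (hu : Q.mulVec u = u) :
    ∃ c, ∀ x, u x = c := by
  obtain ⟨x, hx⟩ := Finite.exists_max u
  refine ⟨u x, fun y => ?_⟩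
  obtain ⟨n, -, hn⟩ := hirr x y
  have e1 := congrFun (pow_fix Q u hu n) x
  have e2 := congrFun (pow_fix Q _ h1 n) x
  simp only [Matrix.mulVec, dotProduct, mul_one] at e1 e2
  have e3 : ∑ z, (Q ^ n) x z * (u x - u z) = 0 := by
    simp only [mul_sub, sum_sub_distrib, ← sum_mul, e1, e2]; ring
  have e4 := (sum_eq_zero_iff_of_nonneg (fun z _ =>
    mul_nonneg (pow_stoch Q h0 n x z) (sub_nonneg.2 (hx z)))).1 e3 y (mem_univ _)
  rcases mul_eq_zero.1 e4 with h | h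
  · exact absurd h hn.ne'
  · linarith

theorem spec_iff (Q : Matrix S S ℝ) (r : ℝ) :
    r ∈ spectrum ℝ Q ↔ ∃ u : S → ℝ, u ≠ 0 ∧ Q.mulVec u = r • u := by
  rw [← Matrix.spectrum_toLin', ← Module.End.hasEigenvalue_iff_mem_spectrum]
  constructor
  · intro h
    obtain ⟨u, hu⟩ := h.exists_hasEigenvector
    exact ⟨u, hu.2, by simpa using hu.apply_eq_smul⟩
  · rintro ⟨u, h0, hu⟩
    refine Module.End.hasEigenvalue_of_hasEigenvector (x := u) ⟨?_, h0⟩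
    rw [Module.End.mem_eigenspace_iff]; simpa using hu

theorem spec_bounds (P Padj Pdot : Matrix S S ℝ) (hP0 : ∀ x y, 0 ≤ P x y)
    (hP1 : ∀ x, ∑ y, P x y = 1)
    (π : S → ℝ) (hπpos : ∀ x, 0 < π x) (hstat : ∀ y, ∑ x, π x * P x y = π y)
    (hPadj : ∀ x y, Padj x y = π y * P y x / π x) (hPdot : Pdot = Padj * P)
    (r : ℝ) (hr : r ∈ spectrum ℝ Pdot) : 0 ≤ r ∧ r ≤ 1 := by
  obtain ⟨u, hu0, hu⟩ := (spec_iff _ _).1 hr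
  have h1 := form P Padj Pdot π hπpos hPadj hPdot u u
  rw [hu] at h1
  have h2 := contraction P hP0 hP1 π hπpos hstat u
  have h3 : 0 < ∑ x, π x * u x ^ 2 := by
    obtain ⟨x, hx⟩ := Function.ne_iff.1 hu0
    refine sum_pos' (fun x _ => mul_nonneg (hπpos x).le (sq_nonneg _)) ⟨x, mem_univ _, ?_⟩
    have : u x ≠ 0 := hx
    exact mul_pos (hπpos x) (by positivity)
  have h4 : r * ∑ x, π x * u x ^ 2 = ∑ x, π x * (P.mulVec u x) ^ 2 := by
    rw [mul_sum]
    convert h1 using 2 with x _ x _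
    · simp; ring
    · ring
  have h5 : 0 ≤ ∑ x, π x * (P.mulVec u x) ^ 2 :=
    sum_nonneg fun x _ => mul_nonneg (hπpos x).le (sq_nonneg _)
  constructor <;> nlinarith

theorem gap [Nonempty S] (P Padj Pdot : Matrix S S ℝ) (hP0 : ∀ x y, 0 ≤ P x y)
    (hP1 : ∀ x, ∑ y, P x y = 1)
    (π : S → ℝ) (hπpos : ∀ x, 0 < π x) (hstat : ∀ y, ∑ x, π x * P x y = π y)
    (hPadj : ∀ x y, Padj x y = π y * P y x / π x) (hPdot : Pdot = Padj * P)
    (hdotirr : ∀ x y, ∃ n, 1 ≤ n ∧ 0 < (Pdot ^ n) x y)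
    (lam : ℝ) (hlam : lam = sSup {r : ℝ | r ∈ spectrum ℝ Pdot ∧ r ≠ 1})
    (w : S → ℝ) (hw : ∑ x, π x * w x = 0) :
    ∑ x, π x * (P.mulVec w x) ^ 2 ≤ lam * ∑ x, π x * w x ^ 2 := by
  set s : S → ℝ := fun x => Real.sqrt (π x) with hs
  have hspos : ∀ x, 0 < s x := fun x => Real.sqrt_pos.2 (hπpos x)
  have hss : ∀ x, s x * s x = π x := fun x => Real.mul_self_sqrt (hπpos x).le
  set A : Matrix S S ℝ := Matrix.of fun x y => s x * Pdot x y / s y with hA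
  have hAmul : ∀ v : S → ℝ, ∀ x, A.mulVec v x = s x * Pdot.mulVec (fun y => v y / s y) x := by
    intro v x
    simp only [Matrix.mulVec, dotProduct, hA, Matrix.of_apply, mul_sum]
    exact sum_congr rfl fun y _ => by ring
  have hdot : ∀ x y, π x * Pdot x y = ∑ z, π z * P z x * P z y := by
    intro x y
    rw [hPdot, Matrix.mul_apply, mul_sum]
    refine sum_congr rfl fun z _ => ?_
    rw [hPadj]
    have := (hπpos x).ne'
    field_simp
  have hherm : A.IsHermitian := by
    ext x y
    simp only [hA, Matrix.conjTranspose_apply, Matrix.of_apply, star_trivial]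
    have h1 : π x * Pdot x y = π y * Pdot y x := by
      rw [hdot, hdot]; exact sum_congr rfl fun z _ => by ring
    rw [← hss, ← hss] at h1
    rw [div_eq_div_iff (hspos x).ne' (hspos y).ne']
    linarith
  have hbdd : BddAbove {r : ℝ | r ∈ spectrum ℝ Pdot ∧ r ≠ 1} :=
    ⟨1, fun r hr => (spec_bounds P Padj Pdot hP0 hP1 π hπpos hstat hPadj hPdot r hr.1).2⟩
  have hdot0 : ∀ x y, 0 ≤ Pdot x y := by
    intro x y
    rw [hPdot, Matrix.mul_apply]
    refine sum_nonneg fun z _ => mul_nonneg ?_ (hP0 _ _)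
    rw [hPadj]
    exact div_nonneg (mul_nonneg (hπpos _).le (hP0 _ _)) (hπpos _).le
  have hdot1 : Pdot.mulVec (fun _ => 1) = fun _ => 1 := by
    rw [hPdot, ← Matrix.mulVec_mulVec]
    have : P.mulVec (fun _ => 1) = fun _ => 1 := by
      ext x; simp [Matrix.mulVec, dotProduct, hP1]
    rw [this]
    ext x
    simp only [Matrix.mulVec, dotProduct, mul_one, hPadj]
    rw [← sum_div, hstat, div_self (hπpos x).ne']
  -- eigenbasis
  set b := hherm.eigenvectorBasis with hb
  set W : EuclideanSpace ℝ S := WithLp.toLp 2 (fun x => s x * w x) with hW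
  have hkey : ∀ i, hherm.eigenvalues i * (inner ℝ (b i) W) ^ 2 ≤ lam * (inner ℝ (b i) W) ^ 2 := by
    intro i
    have hev := hherm.mulVec_eigenvectorBasis i
    set v : S → ℝ := (b i).ofLp with hv
    set u : S → ℝ := fun y => v y / s y with hu
    have hPu : Pdot.mulVec u = hherm.eigenvalues i • u := by
      ext x
      have h := congrFun hev x
      have h' := hAmul v x
      have h'' : s x * Pdot.mulVec u x = hherm.eigenvalues i * v x := by
        rw [← h']; simpa using h
      have := (hspos x).ne'
      simp only [Pi.smul_apply, smul_eq_mul, hu]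
      rw [← mul_div_assoc, eq_div_iff this, ← h'']; simp only [hu]; ring
    by_cases h1 : hherm.eigenvalues i = 1
    · rw [h1, one_smul] at hPu
      obtain ⟨c, hc⟩ := const_of_fix Pdot hdot0 hdot1 hdotirr u hPu
      have : inner ℝ (b i) W = 0 := by
        have hvx : ∀ x, v x = c * s x := fun x => by
          rw [← hc x]; simp only [hu]; rw [div_mul_cancel₀ _ (hspos x).ne']
        have : inner ℝ (b i) W = ∑ x, (s x * w x) * v x := by
          simp [PiLp.inner_apply, hW, hv]
        rw [this]
        calc ∑ x, (s x * w x) * v x = c * ∑ x, π x * w x := by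
              rw [mul_sum]
              exact sum_congr rfl fun x _ => by rw [hvx, ← hss]; ring
          _ = 0 := by rw [hw, mul_zero]
      rw [this]; simp
    · refine mul_le_mul_of_nonneg_right ?_ (sq_nonneg _)
      rw [hlam]
      refine le_csSup hbdd ⟨(spec_iff _ _).2 ⟨u, ?_, hPu⟩, h1⟩
      intro h0
      have : b i = 0 := by
        ext x
        have := congrFun h0 x
        simp only [hu, Pi.zero_apply, div_eq_zero_iff, (hspos x).ne', or_false] at this
        simpa [hv] using this
      exact b.orthonormal.ne_zero i this
  have hform := form P Padj Pdot π hπpos hPadj hPdot w w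
  have hn : ∑ x, π x * w x ^ 2 = ∑ i, (inner ℝ (b i) W) ^ 2 := by
    have h := b.sum_sq_norm_inner_right W
    simp only [Real.norm_eq_abs, sq_abs] at h
    rw [h, EuclideanSpace.norm_sq_eq]
    refine sum_congr rfl fun x _ => ?_
    simp only [hW, Real.norm_eq_abs, sq_abs]
    rw [← hss]; ring
  have hq : ∑ x, π x * (P.mulVec w x) ^ 2 = ∑ i, hherm.eigenvalues i * (inner ℝ (b i) W) ^ 2 := by
    have h1 : ∑ x, π x * (P.mulVec w x) ^ 2 = inner ℝ W (WithLp.toLp 2 (A.mulVec W.ofLp)) := by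
      simp only [PiLp.inner_apply, hW, hAmul]
      simp only [pow_two]
      rw [← hform]
      refine sum_congr rfl fun x _ => ?_
      have : (fun y => s y * w y / s y) = w := by
        ext y; rw [mul_div_cancel_left₀ _ (hspos y).ne']
      rw [this, ← hss]
      simp; ring
    rw [h1, ← b.sum_inner_mul_inner]
    refine sum_congr rfl fun i _ => ?_
    have h2 : inner ℝ (b i) (WithLp.toLp 2 (A.mulVec W.ofLp))
        = hherm.eigenvalues i * inner ℝ (b i) W := by
      have hev := hherm.mulVec_eigenvectorBasis i
      have hAt : A.transpose = A := by simpa [Matrix.IsHermitian] using hherm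
      have h3 : inner ℝ (b i) (WithLp.toLp 2 (A.mulVec W.ofLp)) =
          (b i).ofLp ⬝ᵥ A.mulVec W.ofLp := by
        simp [PiLp.inner_apply, dotProduct, mul_comm]
      rw [h3, Matrix.dotProduct_mulVec, ← Matrix.mulVec_transpose, hAt, hb, hev, smul_dotProduct]
      simp [PiLp.inner_apply, dotProduct, mul_comm]
    rw [h2, real_inner_comm]; ring
  rw [hq, hn, mul_sum]
  exact sum_le_sum fun i _ => hkey i

theorem amgm (A Z : ℝ) : 2 * A * Z ≤ 5 / 16 * A ^ 2 + 16 / 5 * Z ^ 2 := by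
  nlinarith [sq_nonneg (5 / 16 * A - Z)]

theorem pointwise (υ γ a z F : ℝ) (hυ0 : 0 ≤ υ) (hυ1 : υ ≤ 1) (hγ0 : 0 < γ) (hγ1 : γ ≤ 1)
    (hF : |F| ≤ 1) : (Real.exp (γ * υ / 14 * F) * (a + z)) ^ 2 ≤
      a ^ 2 * (1 + γ ^ 2 * υ / 14) + (γ * υ / 7 * a ^ 2) * F + 2 * a * z
        + (1 + 8 / 49 * υ + 8 / 49 * υ * (16 / 5)) * z ^ 2 := by
  set h := γ * υ / 7 with hh
  have hγυ : 0 ≤ γ * υ := by positivity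
  have hγυ1 : γ * υ ≤ 1 := mul_le_one₀ hγ1 hυ0 hυ1
  rw [mul_pow, ← Real.exp_nat_mul]
  have he : ((2 : ℕ) : ℝ) * (γ * υ / 14 * F) = h * F := by rw [hh]; push_cast; ring
  rw [he]
  set g := h * F with hg
  have hfx := abs_le.1 (hF)
  have hhn : 0 ≤ h := by positivity
  have hg1 : |g| ≤ h := by
    rw [hg, abs_mul, abs_of_nonneg hhn]; exact mul_le_of_le_one_right hhn (hF)
  have hh7 : h ≤ 1 / 7 := by rw [hh]; linarith
  have hg2 : g ^ 2 ≤ h ^ 2 := by rw [← sq_abs]; gcongr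
  have hexp := Real.abs_exp_sub_one_sub_id_le (x := g) (by linarith)
  have hexp' := abs_le.1 hexp
  have hE1 : Real.exp g ≤ 1 + g + h ^ 2 := by linarith [hexp'.2]
  have hg3 := abs_le.1 hg1
  have hE2 : |Real.exp g - 1| ≤ 8 / 7 * h := by
    rw [abs_le]
    have : h ^ 2 ≤ 1 / 7 * h := by rw [pow_two]; exact mul_le_mul_of_nonneg_right hh7 hhn
    constructor <;> linarith [hexp'.1, hexp'.2]
  have hE3 : Real.exp g ≤ 1 + 8 / 49 * υ := by
    have := (abs_le.1 hE2).2
    have : h ≤ υ / 7 := by rw [hh]; linarith [mul_le_of_le_one_left hυ0 hγ1]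
    linarith
  have hcross : 2 * a * (Real.exp g - 1) * z ≤
      8 / 49 * υ * (5 / 16 * (γ * a) ^ 2 + 16 / 5 * z ^ 2) := by
    have h1 : 2 * a * (Real.exp g - 1) * z ≤ 2 * |a| * (8 / 7 * h) * |z| := by
      calc _ ≤ |2 * a * (Real.exp g - 1) * z| := le_abs_self _
        _ = 2 * |a| * |Real.exp g - 1| * |z| := by simp [abs_mul]
        _ ≤ _ := by gcongr
    have h2 : 2 * |a| * (8 / 7 * h) * |z| = 8 / 49 * υ * (2 * (γ * |a|) * |z|) := by
      rw [hh]; ring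
    rw [h2] at h1
    refine h1.trans (mul_le_mul_of_nonneg_left ?_ (by positivity))
    rw [mul_pow, ← sq_abs a, ← sq_abs z, ← mul_pow]
    exact amgm _ _
  have hA : a ^ 2 * Real.exp g ≤ a ^ 2 * (1 + g + γ ^ 2 * υ / 49) := by
    refine mul_le_mul_of_nonneg_left (hE1.trans ?_) (sq_nonneg _)
    have : h ^ 2 ≤ γ ^ 2 * υ / 49 := by
      rw [hh]
      have : γ ^ 2 * υ * υ ≤ γ ^ 2 * υ := mul_le_of_le_one_right (by positivity) hυ1
      have e : (γ * υ / 7) ^ 2 = γ ^ 2 * υ * υ / 49 := by ring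
      rw [e]; linarith
    linarith
  have hZ : Real.exp g * z ^ 2 ≤ (1 + 8 / 49 * υ) * z ^ 2 :=
    mul_le_mul_of_nonneg_right hE3 (sq_nonneg _)
  have : Real.exp g * (a + z) ^ 2 = a ^ 2 * Real.exp g + 2 * a * (Real.exp g - 1) * z
    + 2 * a * z + Real.exp g * z ^ 2 := by ring
  rw [this]
  have hgg : a ^ 2 * g = h * a ^ 2 * F := by rw [hg]; ring
  linarith

/-- the one-step bound -/
theorem step (P : Matrix S S ℝ) (hP1 : ∀ x, ∑ y, P x y = 1)
    (π : S → ℝ) (hπpos : ∀ x, 0 < π x) (hπ1 : ∑ x, π x = 1)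
    (hstat : ∀ y, ∑ x, π x * P x y = π y)
    (υ : ℝ) (hυ0 : 0 ≤ υ) (hυ1 : υ ≤ 1)
    (hgap : ∀ w : S → ℝ, ∑ x, π x * w x = 0 →
      ∑ x, π x * (P.mulVec w x) ^ 2 ≤ (1 - υ) * ∑ x, π x * w x ^ 2)
    (f : S → ℝ) (hf0 : ∑ y, π y * f y = 0) (hfinf : ∀ y, |f y| ≤ 1)
    (γ : ℝ) (hγ0 : 0 < γ) (hγ1 : γ ≤ 1) (u : S → ℝ) :
    ∑ x, π x * (Real.exp (γ * υ / 14 * f x) * P.mulVec u x) ^ 2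
      ≤ (1 + γ ^ 2 * υ / 14) * ∑ x, π x * u x ^ 2 := by
  set a := ∑ x, π x * u x with ha
  set w : S → ℝ := fun x => u x - a with hw
  have hw0 : ∑ x, π x * w x = 0 := by
    simp only [hw, mul_sub, sum_sub_distrib, ← sum_mul, hπ1]; rw [← ha]; ring
  set z := P.mulVec w with hz
  have hz0 : ∑ x, π x * z x = 0 := by rw [hz, mean_mulVec P π hstat, hw0]
  have hzB := hgap w hw0
  set B := ∑ x, π x * w x ^ 2 with hB
  have hBnn : 0 ≤ B := sum_nonneg fun x _ => mul_nonneg (hπpos x).le (sq_nonneg _)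
  have hu2 : ∑ x, π x * u x ^ 2 = a ^ 2 + B := by
    have : ∀ x, π x * u x ^ 2 = π x * a ^ 2 + 2 * a * (π x * w x) + π x * w x ^ 2 := by
      intro x; simp only [hw]; ring
    simp only [this, sum_add_distrib, ← sum_mul, ← mul_sum, hπ1, hw0]; simp [hB]
  have hPu : ∀ x, P.mulVec u x = a + z x := by
    intro x
    simp only [hz, hw, Matrix.mulVec, dotProduct, mul_sub, sum_sub_distrib, ← sum_mul, hP1]
    ring
  set h := γ * υ / 7 with hh
  have hpt : ∀ x, (Real.exp (γ * υ / 14 * f x) * P.mulVec u x) ^ 2 ≤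
      a ^ 2 * (1 + γ ^ 2 * υ / 14) + (h * a ^ 2) * f x + 2 * a * z x
        + (1 + 8 / 49 * υ + 8 / 49 * υ * (16 / 5)) * z x ^ 2 := by
    intro x
    rw [hPu]
    exact pointwise υ γ a (z x) (f x) hυ0 hυ1 hγ0 hγ1 (hfinf x)
  calc _ ≤ ∑ x, π x * (a ^ 2 * (1 + γ ^ 2 * υ / 14) + (h * a ^ 2) * f x + 2 * a * z x
        + (1 + 8 / 49 * υ + 8 / 49 * υ * (16 / 5)) * z x ^ 2) :=
        sum_le_sum fun x _ => mul_le_mul_of_nonneg_left (hpt x) (hπpos x).le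
    _ = a ^ 2 * (1 + γ ^ 2 * υ / 14) + (1 + 8 / 49 * υ + 8 / 49 * υ * (16 / 5)) *
        ∑ x, π x * z x ^ 2 := by
        have : ∀ x, π x * (a ^ 2 * (1 + γ ^ 2 * υ / 14) + (h * a ^ 2) * f x + 2 * a * z x
          + (1 + 8 / 49 * υ + 8 / 49 * υ * (16 / 5)) * z x ^ 2) =
          π x * (a ^ 2 * (1 + γ ^ 2 * υ / 14)) + (h * a ^ 2) * (π x * f x)
          + 2 * a * (π x * z x)
          + (1 + 8 / 49 * υ + 8 / 49 * υ * (16 / 5)) * (π x * z x ^ 2) := fun x => by ring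
        simp only [this, sum_add_distrib, ← sum_mul, ← mul_sum, hπ1, hz0, hf0]
        ring
    _ ≤ a ^ 2 * (1 + γ ^ 2 * υ / 14) + (1 + 8 / 49 * υ + 8 / 49 * υ * (16 / 5)) *
        ((1 - υ) * B) := by gcongr
    _ ≤ _ := by
        rw [hu2]
        have h1 : (1 + 8 / 49 * υ + 8 / 49 * υ * (16 / 5)) * (1 - υ) ≤ 1 + γ ^ 2 * υ / 14 := by
          have : 0 ≤ γ ^ 2 * υ := by positivity
          nlinarith [sq_nonneg υ]
        nlinarith [mul_le_mul_of_nonneg_right h1 hBnn]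

/-- `(D P)^n 1` -/
noncomputable def vec (P : Matrix S S ℝ) (D : S → ℝ) : ℕ → S → ℝ
  | 0 => fun _ => 1
  | n + 1 => fun x => D x * P.mulVec (vec P D n) x

theorem path_sum (P : Matrix S S ℝ) (hP1 : ∀ x, ∑ y, P x y = 1) (D : S → ℝ) (n : ℕ) (x : S) :
    ∑ p : Fin n → S, (∏ i : Fin n, P ((Fin.cons x p : Fin (n + 1) → S) i.castSucc) (p i)) *
      (D x * ∏ i : Fin n, D (p i)) = vec P D (n + 1) x := by
  induction n generalizing x with
  | zero => simp [vec, Matrix.mulVec, dotProduct, hP1]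
  | succ n ih =>
    have hv : vec P D (n + 1 + 1) x = ∑ y, D x * (P x y * vec P D (n + 1) y) := by
      rw [← mul_sum]; rfl
    rw [hv, ← (Fin.consEquiv (fun _ => S)).sum_comp, Fintype.sum_prod_type]
    refine sum_congr rfl fun y _ => ?_
    rw [← ih y, mul_sum, mul_sum]
    refine sum_congr rfl fun p _ => ?_
    simp only [Fin.consEquiv_apply, Fin.prod_univ_succ, Fin.castSucc_zero, Fin.cons_zero,
      Fin.cons_succ, ← Fin.succ_castSucc]
    ring

theorem vec_bound (P : Matrix S S ℝ) (D : S → ℝ) (π : S → ℝ) (hπ1 : ∑ x, π x = 1)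
    (M : ℝ) (hM : 0 ≤ M)
    (hstep : ∀ u : S → ℝ, ∑ x, π x * (D x * P.mulVec u x) ^ 2 ≤ M * ∑ x, π x * u x ^ 2) (n : ℕ) :
    ∑ x, π x * (vec P D n x) ^ 2 ≤ M ^ n := by
  induction n with
  | zero => simp [vec, hπ1]
  | succ n ih =>
    calc _ ≤ M * ∑ x, π x * (vec P D n x) ^ 2 := hstep _
      _ ≤ M * M ^ n := by gcongr
      _ = _ := by ring

theorem cyl [MeasurableSpace S] [MeasurableSingletonClass S] {Ω : Type*} [MeasurableSpace Ω]
    (P : Matrix S S ℝ) (hP1 : ∀ x, ∑ y, P x y = 1) (q : S → ℝ)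
    (μ : Measure Ω) [IsProbabilityMeasure μ]
    (X : ℕ → Ω → S) (hXmeas : ∀ t, Measurable (X t))
    (hdist : ∀ T : ℕ, 1 ≤ T → ∀ w : ℕ → S,
      (μ {ω | ∀ t ∈ Finset.Icc 1 T, X t ω = w t}).toReal
        = q (w 1) * ∏ t ∈ Finset.Ico 1 T, P (w t) (w (t + 1)))
    (n : ℕ) (f : S → ℝ) (γ r : ℝ) (hr : 0 ≤ r) :
    (μ {ω | γ ≤ (∑ t ∈ Finset.Icc 1 (n + 1), f (X t ω)) / (n + 1 : ℕ)}).toReal ≤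
      Real.exp (-(r * ((n + 1 : ℕ) * γ))) *
        ∑ x, q x * vec P (fun x => Real.exp (r * f x)) (n + 1) x := by
  set Y : Ω → (Fin (n + 1) → S) := fun ω i => X (i + 1) ω with hY
  have hYm : Measurable Y := measurable_pi_lambda _ fun i => hXmeas _
  have hYp : ∀ p, μ.real (Y ⁻¹' {p}) = q (p 0) * ∏ i : Fin n, P (p i.castSucc) (p i.succ) := by
    intro p
    set w : ℕ → S := fun t => if h : t - 1 < n + 1 then p ⟨t - 1, h⟩ else p 0 with hw
    have hset : Y ⁻¹' {p} = {ω | ∀ t ∈ Finset.Icc 1 (n + 1), X t ω = w t} := by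
      ext ω
      simp only [Set.mem_preimage, Set.mem_singleton_iff, Set.mem_ofPred_eq, Finset.mem_Icc]
      constructor
      · rintro rfl t ⟨h1, h2⟩
        have h3 : t - 1 < n + 1 := by omega
        simp only [hw, h3, dite_true, hY]
        rw [Nat.sub_add_cancel h1]
      · intro h
        ext i
        have h4 := h (i + 1) ⟨by omega, by omega⟩
        simpa [hw, hY, Nat.lt_succ_iff.1 i.2] using h4
    rw [hset, Measure.real, hdist _ (by omega), Finset.prod_Ico_eq_prod_range]
    congr 1
    rw [show n + 1 - 1 = n from rfl, Finset.prod_range]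
    refine prod_congr rfl fun i _ => ?_
    have e1 : (1 + (i : ℕ)) - 1 < n + 1 := by omega
    have e2 : (1 + (i : ℕ) + 1) - 1 < n + 1 := by omega
    simp only [hw, e1, e2, dite_true]
    congr 2
    · ext; simp
    · ext; simp [add_comm]
  have hYp0 : ∀ p : Fin (n + 1) → S, 0 ≤ q (p 0) * ∏ i : Fin n, P (p i.castSucc) (p i.succ) := fun p => by
    rw [← hYp]; exact measureReal_nonneg
  set F : Finset (Fin (n + 1) → S) := univ.filter fun p => (n + 1 : ℕ) * γ ≤ ∑ i, f (p i) with hF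
  have hev : {ω | γ ≤ (∑ t ∈ Finset.Icc 1 (n + 1), f (X t ω)) / (n + 1 : ℕ)} = Y ⁻¹' (F : Set _) := by
    ext ω
    have hs : ∑ t ∈ Finset.Icc 1 (n + 1), f (X t ω) = ∑ i : Fin (n + 1), f (X (i + 1) ω) := by
      rw [← Finset.sum_range (fun i => f (X (i + 1) ω)), Finset.range_eq_Ico,
        Finset.sum_Ico_add' (fun t => f (X t ω)) 0 (n + 1) 1]
      rfl
    simp only [Set.mem_ofPred_eq, hs, hF, Set.mem_preimage, coe_filter, mem_univ, true_and, hY]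
    rw [le_div_iff₀ (by positivity), mul_comm]
  have h1 : (μ {ω | γ ≤ (∑ t ∈ Finset.Icc 1 (n + 1), f (X t ω)) / (n + 1 : ℕ)}).toReal
      = ∑ p ∈ F, μ.real (Y ⁻¹' {p}) := by
    rw [hev, sum_measureReal_preimage_singleton _ (fun p _ => hYm (measurableSet_singleton p))]
    rfl
  rw [h1]
  have h2 : ∑ x, q x * vec P (fun x => Real.exp (r * f x)) (n + 1) x =
      ∑ p : Fin (n + 1) → S, (q (p 0) * ∏ i : Fin n, P (p i.castSucc) (p i.succ)) *
        Real.exp (r * ∑ i, f (p i)) := by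
    rw [← (Fin.consEquiv (fun _ => S)).sum_comp, Fintype.sum_prod_type]
    refine sum_congr rfl fun x _ => ?_
    rw [← path_sum P hP1, mul_sum]
    refine sum_congr rfl fun p _ => ?_
    simp only [Fin.consEquiv_apply, Fin.cons_zero, Fin.cons_succ, Fin.sum_univ_succ, mul_add,
      Real.exp_add, mul_sum, Real.exp_sum]
    ring
  rw [h2, mul_sum]
  calc ∑ p ∈ F, μ.real (Y ⁻¹' {p}) ≤ ∑ p ∈ F, Real.exp (-(r * ((n + 1 : ℕ) * γ))) *
        ((q (p 0) * ∏ i : Fin n, P (p i.castSucc) (p i.succ)) *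
        Real.exp (r * ∑ i, f (p i))) := by
        refine sum_le_sum fun p hp => ?_
        rw [hYp]
        have hp' : (n + 1 : ℕ) * γ ≤ ∑ i, f (p i) := (mem_filter.1 hp).2
        rw [mul_left_comm, ← Real.exp_add]
        refine le_mul_of_one_le_right (hYp0 p) (Real.one_le_exp ?_)
        have := mul_le_mul_of_nonneg_left hp' hr
        linarith
    _ ≤ _ := sum_le_sum_of_subset_of_nonneg (subset_univ _) fun p _ _ =>
        mul_nonneg (Real.exp_pos _).le (mul_nonneg (hYp0 p) (Real.exp_pos _).le)

end LezaudAux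

/-- **Lezaud's Chernoff bound for Markov chains** (Theorem 3.3 of Lezaud 1998).
For a finite-state irreducible Markov chain `{X_t}_{t ≥ 1}` with transition matrix `P`,
initial distribution `q` and stationary distribution `π`, if the multiplicative
symmetrization `Ṗ = P'P` is irreducible and `υ` is its eigenvalue gap, then for any
function `f` with `π`-mean zero, `‖f‖_∞ ≤ 1` and `0 < ‖f‖₂² ≤ 1`, any `T ≥ 1` and
`0 < γ ≤ 1`, `P( (1/T) Σ_{t=1}^T f(X_t) ≥ γ ) ≤ V_q exp(-T γ² υ / 28)`. -/
theorem lezaud_chernoff_markov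
    (S : Type*) [Fintype S] [Nonempty S] [DecidableEq S]
    [MeasurableSpace S] [MeasurableSingletonClass S]
    (P : Matrix S S ℝ)
    (hstoch : (∀ x y, 0 ≤ P x y) ∧ ∀ x, ∑ y, P x y = 1)
    (hirr : ∀ x y, ∃ n, 1 ≤ n ∧ 0 < (P ^ n) x y)
    (q : S → ℝ) (hq0 : ∀ x, 0 ≤ q x) (hq1 : ∑ x, q x = 1)
    (π : S → ℝ) (hπpos : ∀ x, 0 < π x) (hπ1 : ∑ x, π x = 1)
    (hstat : ∀ y, ∑ x, π x * P x y = π y)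
    -- the adjoint `P'` of `P` on `ℓ²(π)` and the multiplicative symmetrization `Ṗ = P'P`
    (Padj : Matrix S S ℝ) (hPadj : ∀ x y, Padj x y = π y * P y x / π x)
    (Pdot : Matrix S S ℝ) (hPdot : Pdot = Padj * P)
    -- `Ṗ` is irreducible
    (hdotirr : ∀ x y, ∃ n, 1 ≤ n ∧ 0 < (Pdot ^ n) x y)
    -- `λ₂` is the second largest eigenvalue of `Ṗ`, and `υ = 1 - λ₂` the eigenvalue gap
    (lam2 : ℝ) (hlam2 : lam2 = sSup {r : ℝ | r ∈ spectrum ℝ Pdot ∧ r ≠ 1})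
    (υ : ℝ) (hυ : υ = 1 - lam2)
    -- `V_q = ‖(q_x/π_x)_{x ∈ S}‖₂` in `ℓ²(π)`
    (Vq : ℝ) (hVq : Vq = Real.sqrt (∑ x, π x * (q x / π x) ^ 2))
    -- the function `f` has `π`-mean zero, `‖f‖_∞ ≤ 1` and `0 < ‖f‖₂² ≤ 1`
    (f : S → ℝ) (hf0 : ∑ y, π y * f y = 0) (hfinf : ∀ y, |f y| ≤ 1)
    (hf2pos : 0 < ∑ y, π y * f y ^ 2) (hf2le : ∑ y, π y * f y ^ 2 ≤ 1)
    -- the Markov chain `{X_t}_{t ≥ 1}`: initial distribution `q`, transitions `P`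
    (Ω : Type*) [MeasurableSpace Ω] (μ : Measure Ω) [IsProbabilityMeasure μ]
    (X : ℕ → Ω → S) (hXmeas : ∀ t, Measurable (X t))
    (hdist : ∀ T : ℕ, 1 ≤ T → ∀ w : ℕ → S,
      (μ {ω | ∀ t ∈ Finset.Icc 1 T, X t ω = w t}).toReal
        = q (w 1) * ∏ t ∈ Finset.Ico 1 T, P (w t) (w (t + 1)))
    (T : ℕ) (hT : 1 ≤ T) (γ : ℝ) (hγ0 : 0 < γ) (hγ1 : γ ≤ 1) :
    (μ {ω | γ ≤ (∑ t ∈ Finset.Icc 1 T, f (X t ω)) / T}).toReal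
      ≤ Vq * Real.exp (-(T * γ ^ 2 * υ) / 28) := by
  have hb := fun r hr => LezaudAux.spec_bounds P Padj Pdot hstoch.1 hstoch.2 π hπpos hstat hPadj
    hPdot r hr
  have hl0 : 0 ≤ lam2 := by
    rw [hlam2]; exact Real.sSup_nonneg fun r hr => (hb r hr.1).1
  have hl1 : lam2 ≤ 1 := by
    rw [hlam2]; exact Real.sSup_le (fun r hr => (hb r hr.1).2) zero_le_one
  have hυ0 : 0 ≤ υ := by linarith
  have hυ1 : υ ≤ 1 := by linarith
  have hgap : ∀ w : S → ℝ, ∑ x, π x * w x = 0 →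
      ∑ x, π x * (P.mulVec w x) ^ 2 ≤ (1 - υ) * ∑ x, π x * w x ^ 2 := by
    intro w hw
    have := LezaudAux.gap P Padj Pdot hstoch.1 hstoch.2 π hπpos hstat hPadj hPdot hdotirr lam2
      hlam2 w hw
    rwa [hυ, sub_sub_cancel]
  obtain ⟨n, rfl⟩ : ∃ n, T = n + 1 := ⟨T - 1, by omega⟩
  have hmain := LezaudAux.cyl P hstoch.2 q μ X hXmeas hdist n f γ (γ * υ / 14) (by positivity)
  have hvb := LezaudAux.vec_bound P (fun x => Real.exp (γ * υ / 14 * f x)) π hπ1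
    (1 + γ ^ 2 * υ / 14) (by positivity)
    (LezaudAux.step P hstoch.2 π hπpos hπ1 hstat υ hυ0 hυ1 hgap f hf0 hfinf γ hγ0 hγ1) (n + 1)
  set v := LezaudAux.vec P (fun x => Real.exp (γ * υ / 14 * f x)) (n + 1) with hv
  have hexp : (1 + γ ^ 2 * υ / 14) ^ (n + 1) ≤
      Real.exp ((n + 1 : ℕ) * (γ ^ 2 * υ) / 28) ^ 2 := by
    rw [← Real.exp_nat_mul]
    have h1 : 1 + γ ^ 2 * υ / 14 ≤ Real.exp (γ ^ 2 * υ / 14) := by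
      linarith [Real.add_one_le_exp (γ ^ 2 * υ / 14)]
    calc _ ≤ Real.exp (γ ^ 2 * υ / 14) ^ (n + 1) := by gcongr
      _ = _ := by
        rw [← Real.exp_nat_mul]; congr 1; push_cast; ring
  have hcs : ∑ x, q x * v x ≤ Vq * Real.exp ((n + 1 : ℕ) * (γ ^ 2 * υ) / 28) := by
    have h := Real.sum_mul_le_sqrt_mul_sqrt univ (fun x => Real.sqrt (π x) * (q x / π x))
      (fun x => Real.sqrt (π x) * v x)
    simp only [mul_pow, Real.sq_sqrt (hπpos _).le] at h
    have e : ∀ x, Real.sqrt (π x) * (q x / π x) * (Real.sqrt (π x) * v x) = q x * v x := by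
      intro x
      have h0 := (hπpos x).ne'
      calc _ = (Real.sqrt (π x) * Real.sqrt (π x)) * (q x / π x) * v x := by ring
        _ = _ := by rw [Real.mul_self_sqrt (hπpos x).le, mul_div_cancel₀ _ h0]
    simp only [e] at h
    rw [← hVq] at h
    refine h.trans (mul_le_mul_of_nonneg_left ?_ (by rw [hVq]; exact Real.sqrt_nonneg _))
    exact Real.sqrt_le_iff.2 ⟨(Real.exp_pos _).le, hvb.trans hexp⟩
  refine hmain.trans ((mul_le_mul_of_nonneg_left hcs (Real.exp_pos _).le).trans (le_of_eq ?_))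
  rw [mul_left_comm, ← Real.exp_add]
  congr 2
  ring
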